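/- Let π be a coarse correlated equilibrium of (Q, Q), i.e. a CCE where both payoff matrices equal Q, and let μ(a) = Σ_b π(a,b) and ν(b) = Σ_a π(a,b) be the marginal distributions of π over 𝒜 and ℬ respectively. Then (μ, ν) is a Nash equilibrium of the zero-sum matrix game with payoff Q: max_{a* ∈ 𝒜} Σ_{b ∈ ℬ} ν(b)·Q(a*, b) = min_{b* ∈ ℬ} Σ_{a ∈ 𝒜} μ(a)·Q(a, b*), and both quantities equal Σ_{a,b} π(a,b)·Q(a,b). -/

import Mathlib

theorem cce_marginals_nash (A B : Type*) [Fintype A] [Fintype B] [Nonempty A] [Nonempty B]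
    (Q : A → B → ℝ) (pdist : A × B → ℝ)
    (hpos : ∀ p, 0 ≤ pdist p) (hsum : ∑ p : A × B, pdist p = 1)
    (hcce1 : ∀ astar : A, ∑ p : A × B, pdist p * Q astar p.2 ≤ ∑ p : A × B, pdist p * Q p.1 p.2)
    (hcce2 : ∀ bstar : B, ∑ p : A × B, pdist p * Q p.1 p.2 ≤ ∑ p : A × B, pdist p * Q p.1 bstar) :
    (Finset.univ.sup' Finset.univ_nonempty fun astar : A =>
        ∑ b : B, (∑ a : A, pdist (a, b)) * Q astar b) = ∑ p : A × B, pdist p * Q p.1 p.2 ∧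
    (Finset.univ.inf' Finset.univ_nonempty fun bstar : B =>
        ∑ a : A, (∑ b : B, pdist (a, b)) * Q a bstar) = ∑ p : A × B, pdist p * Q p.1 p.2 := by
  have e1 : ∀ x : A, ∑ b : B, (∑ a : A, pdist (a, b)) * Q x b
      = ∑ p : A × B, pdist p * Q x p.2 := by
    intro x
    rw [Fintype.sum_prod_type_right]
    simp only [Finset.sum_mul]
  have e2 : ∀ y : B, ∑ a : A, (∑ b : B, pdist (a, b)) * Q a y
      = ∑ p : A × B, pdist p * Q p.1 y := by
    intro y
    rw [Fintype.sum_prod_type]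
    simp only [Finset.sum_mul]
  have hmu : ∑ a : A, ∑ b : B, pdist (a, b) = 1 := by
    rw [← hsum, Fintype.sum_prod_type]
  have hnu : ∑ b : B, ∑ a : A, pdist (a, b) = 1 := by
    rw [← hsum, Fintype.sum_prod_type_right]
  set V := ∑ p : A × B, pdist p * Q p.1 p.2 with hV
  set F : A → ℝ := fun x => ∑ b : B, (∑ a : A, pdist (a, b)) * Q x b with hF
  set G : B → ℝ := fun y => ∑ a : A, (∑ b : B, pdist (a, b)) * Q a y with hG
  have hM : Finset.univ.sup' Finset.univ_nonempty F ≤ V :=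
    Finset.sup'_le _ _ fun x _ => (e1 x).trans_le (hcce1 x)
  have hm : V ≤ Finset.univ.inf' Finset.univ_nonempty G :=
    Finset.le_inf' _ _ fun y _ => (hcce2 y).trans_eq (e2 y).symm
  have hFG : ∑ a : A, (∑ b : B, pdist (a, b)) * F a
      = ∑ b : B, (∑ a : A, pdist (a, b)) * G b := by
    simp only [hF, hG, Finset.mul_sum]
    rw [Finset.sum_comm]
    refine Finset.sum_congr rfl fun b _ => Finset.sum_congr rfl fun a _ => ?_
    ring
  have h1 : ∑ a : A, (∑ b : B, pdist (a, b)) * F a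
      ≤ Finset.univ.sup' Finset.univ_nonempty F := by
    calc _ ≤ ∑ a : A, (∑ b : B, pdist (a, b)) * Finset.univ.sup' Finset.univ_nonempty F :=
          Finset.sum_le_sum fun a _ => mul_le_mul_of_nonneg_left
            (Finset.le_sup' F (Finset.mem_univ a)) (Finset.sum_nonneg fun b _ => hpos _)
      _ = _ := by rw [← Finset.sum_mul, hmu, one_mul]
  have h2 : Finset.univ.inf' Finset.univ_nonempty G
      ≤ ∑ b : B, (∑ a : A, pdist (a, b)) * G b := by
    calc _ = ∑ b : B, (∑ a : A, pdist (a, b)) * Finset.univ.inf' Finset.univ_nonempty G := by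
          rw [← Finset.sum_mul, hnu, one_mul]
      _ ≤ _ := Finset.sum_le_sum fun b _ => mul_le_mul_of_nonneg_left
            (Finset.inf'_le G (Finset.mem_univ b)) (Finset.sum_nonneg fun a _ => hpos _)
  constructor <;> linarith
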